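/- arXiv:2006.01399 — 8 statements merged into one kernel-verified Lean document; each statement's English description precedes it below -/
import Mathlib

section
/- A metric space X is complete if and only if for every countable metric space A and every nonexpanding map f : A → X there exists a nonexpanding map f̄ from the completion of A to X such that f̄ ∘ ι = f, where ι : A → Completion A is the canonical embedding of A into its completion. -/
theorem stmt_4 {X : Type*} [MetricSpace X] :
    CompleteSpace X ↔
      ∀ (A : Type) [MetricSpace A] [Countable A] (f : A → X),
        (∀ x y : A, dist (f x) (f y) ≤ dist x y) →
        ∃ g : UniformSpace.Completion A → X,
          (∀ x y : UniformSpace.Completion A, dist (g x) (g y) ≤ dist x y) ∧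
          ∀ a : A, g (a : UniformSpace.Completion A) = f a := by
  constructor
  · intro _ A _ _ f hf
    have hL : LipschitzWith 1 f := LipschitzWith.mk_one hf
    refine ⟨UniformSpace.Completion.extension f, fun x y => ?_, fun a =>
      UniformSpace.Completion.extension_coe hL.uniformContinuous a⟩
    simpa using hL.completion_extension.dist_le_mul x y
  · intro h
    refine Metric.complete_of_cauchySeq_tendsto fun u hu => ?_
    -- the hypothesis only covers spaces in `Type`, so copy the range of `u` there
    obtain ⟨A, ⟨e⟩⟩ := (inferInstance : Small.{0} (Set.range u)).equiv_small
    let f : A → X := fun a => e.symm a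
    have hf : Function.Injective f := Subtype.val_injective.comp e.symm.injective
    let _ : MetricSpace A := MetricSpace.induced f hf inferInstance
    have hdist (a b : A) : dist (f a) (f b) = dist a b := rfl
    have : Countable A := e.symm.countable_iff.2 (Set.countable_range u).to_subtype
    obtain ⟨g, hg, hgf⟩ := h A f fun a b => (hdist a b).le
    let v : ℕ → A := fun n => e ⟨u n, n, rfl⟩
    have hfv (n : ℕ) : f (v n) = u n := by simp [f, v]
    have hv : CauchySeq v := by
      rw [Metric.cauchySeq_iff] at hu ⊢
      simpa only [← hdist, hfv] using hu
    obtain ⟨z, hz⟩ := cauchySeq_tendsto_of_complete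
      ((UniformSpace.Completion.uniformContinuous_coe A).comp_cauchySeq hv)
    refine ⟨g z, ?_⟩
    have hlim := ((LipschitzWith.mk_one hg).continuous.tendsto z).comp hz
    simpa only [Function.comp_def, hgf, hfv] using hlim
end

section
/- Let A and B be metric spaces with A finite, and let u : B → A be a nonexpanding map such that for every ε > 0 there exists a nonexpanding map s : A → B with dist(s (u b), b) ≤ ε for all b ∈ B. Then B is finite. -/
theorem stmt_5 {A B : Type*} [MetricSpace A] [MetricSpace B] [Finite A]
    (u : B → A) (hu : ∀ x y : B, dist (u x) (u y) ≤ dist x y)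
    (hsplit : ∀ ε : ℝ, 0 < ε → ∃ s : A → B,
      (∀ x y : A, dist (s x) (s y) ≤ dist x y) ∧ ∀ b : B, dist (s (u b)) b ≤ ε) :
    Finite B := by
  refine Finite.of_injective u fun x y hxy => eq_of_forall_dist_le fun ε hε => ?_
  obtain ⟨s, -, hs⟩ := hsplit (ε / 2) (half_pos hε)
  have hx := hs x
  rw [hxy] at hx
  linarith [dist_triangle_left x y (s (u y)), hs y]
end

section
/- Let A and B be metric spaces with A separable, and let u : B → A be a nonexpanding map such that for every ε > 0 there exists a nonexpanding map s : A → B with dist(s (u b), b) ≤ ε for all b ∈ B. Then B is separable. -/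
theorem stmt_6 {A B : Type*} [MetricSpace A] [MetricSpace B]
    [TopologicalSpace.SeparableSpace A]
    (u : B → A) (hu : ∀ x y : B, dist (u x) (u y) ≤ dist x y)
    (hsplit : ∀ ε : ℝ, 0 < ε → ∃ s : A → B,
      (∀ x y : A, dist (s x) (s y) ≤ dist x y) ∧ ∀ b : B, dist (s (u b)) b ≤ ε) :
    TopologicalSpace.SeparableSpace B := by
  obtain ⟨D, hDc, hDd⟩ := TopologicalSpace.exists_countable_dense A
  choose s hs hsu using fun n : ℕ => hsplit (1 / ((n : ℝ) + 1)) Nat.one_div_pos_of_nat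
  refine ⟨⋃ n, s n '' D, Set.countable_iUnion fun n => hDc.image _, ?_⟩
  rw [Metric.dense_iff]
  intro b r hr
  obtain ⟨n, hn⟩ := exists_nat_one_div_lt (half_pos hr)
  obtain ⟨d, hdD, hd⟩ := hDd.exists_dist_lt (u b) (half_pos hr)
  refine ⟨s n d, ?_, Set.mem_iUnion.2 ⟨n, d, hdD, rfl⟩⟩
  rw [Metric.mem_ball]
  have h₁ := dist_triangle (s n d) (s n (u b)) b
  have h₂ := hs n d (u b)
  have h₃ := hsu n b
  rw [dist_comm] at hd
  linarith
end

section
/- Let K be a real normed space and let (S_i)_{i ∈ I} be a nonempty family of closed linear subspaces of K that is directed under inclusion and whose union is dense in K. Let A be a finite-dimensional real normed space, let f : A → K be a linear map with ‖f a‖ ≤ ‖a‖ for all a, and let ε > 0. Then there exist an index i ∈ I and a linear map f' : A → S_i with ‖f' a‖ ≤ ‖a‖ for all a, such that ‖f' a − f a‖ ≤ ε (computing the difference in K via the inclusion S_i ⊆ K) for every a ∈ A with ‖a‖ ≤ 1. -/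
/-- A linear map from a finite-dimensional normed space into a normed space exhausted, up to
closure, by a directed family of subspaces is a norm limit of maps factoring through members of
the family. -/
theorem exists_linearMap_sub_le_of_directed_of_dense {K : Type*} [NormedAddCommGroup K]
    [NormedSpace ℝ K] {I : Type*} [Nonempty I] (S : I → Submodule ℝ K)
    (hdir : Directed (· ≤ ·) S) (hdense : Dense (⋃ i : I, (S i : Set K)))
    {A : Type*} [NormedAddCommGroup A] [NormedSpace ℝ A] [FiniteDimensional ℝ A]
    (f : A →ₗ[ℝ] K) (η : ℝ) (hη : 0 < η) :
    ∃ (i : I) (g : A →ₗ[ℝ] (S i)), ∀ a : A, ‖(g a : K) - f a‖ ≤ η * ‖a‖ := by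
  let b := Module.finBasis ℝ A
  obtain ⟨C, hC, hbound⟩ := b.exists_opNorm_le (F := K)
  have hδ : 0 < η / C := div_pos hη hC
  have hx : ∀ j, ∃ x : K, (∃ i, x ∈ S i) ∧ dist (f (b j)) x < η / C := fun j => by
    obtain ⟨x, hx, hd⟩ := hdense.exists_dist_lt (f (b j)) hδ
    exact ⟨x, by simpa using hx, hd⟩
  choose x hmem hdist using hx
  choose k hk using hmem
  obtain ⟨i, hi⟩ := hdir.finite_le k
  let g : A →ₗ[ℝ] S i := b.constr ℝ fun j => ⟨x j, hi j (hk j)⟩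
  let d : A →ₗ[ℝ] K := (S i).subtype ∘ₗ g - f
  have hd : ‖LinearMap.toContinuousLinearMap d‖ ≤ C * (η / C) := by
    refine hbound hδ.le fun j => ?_
    have hj : d (b j) = x j - f (b j) := by simp [d, g]
    rw [LinearMap.coe_toContinuousLinearMap', hj, ← dist_eq_norm, dist_comm]
    exact (hdist j).le
  rw [mul_div_cancel₀ η hC.ne'] at hd
  exact ⟨i, g, fun a => (LinearMap.toContinuousLinearMap d).le_of_opNorm_le hd a⟩

theorem stmt_8 {K : Type*} [NormedAddCommGroup K] [NormedSpace ℝ K]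
    {I : Type*} [Nonempty I] (S : I → Submodule ℝ K)
    (hclosed : ∀ i : I, IsClosed (S i : Set K))
    (hdir : Directed (· ≤ ·) S)
    (hdense : Dense (⋃ i : I, (S i : Set K)))
    {A : Type*} [NormedAddCommGroup A] [NormedSpace ℝ A] [FiniteDimensional ℝ A]
    (f : A →ₗ[ℝ] K) (hf : ∀ a : A, ‖f a‖ ≤ ‖a‖)
    (ε : ℝ) (hε : 0 < ε) :
    ∃ (i : I) (f' : A →ₗ[ℝ] (S i)),
      (∀ a : A, ‖f' a‖ ≤ ‖a‖) ∧
      ∀ a : A, ‖a‖ ≤ 1 → ‖(f' a : K) - f a‖ ≤ ε := by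
  obtain ⟨i, g, hg⟩ :=
    exists_linearMap_sub_le_of_directed_of_dense S hdir hdense f (ε / 2) (half_pos hε)
  have hpos : 0 < 1 + ε / 2 := by positivity
  refine ⟨i, (1 + ε / 2)⁻¹ • g, fun a => ?_, fun a ha => ?_⟩
  · have hga : ‖(g a : K)‖ ≤ (1 + ε / 2) * ‖a‖ := by
      have := norm_le_norm_add_norm_sub' (g a : K) (f a)
      linarith [hg a, hf a]
    rw [LinearMap.smul_apply, norm_smul, norm_inv, Real.norm_of_nonneg hpos.le,
      inv_mul_le_iff₀ hpos]
    exact hga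
  · have hsplit : (((1 + ε / 2)⁻¹ • g) a : K) - f a =
        (1 + ε / 2)⁻¹ • (((g a : K) - f a) - (ε / 2) • f a) := by
      rw [eq_inv_smul_iff₀ hpos.ne', LinearMap.smul_apply, Submodule.coe_smul, smul_sub,
        smul_inv_smul₀ hpos.ne', add_smul, one_smul, sub_sub]
    rw [hsplit, norm_smul, norm_inv, Real.norm_of_nonneg hpos.le, inv_mul_le_iff₀ hpos]
    calc ‖((g a : K) - f a) - (ε / 2) • f a‖
        ≤ ‖(g a : K) - f a‖ + ‖(ε / 2) • f a‖ := norm_sub_le _ _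
      _ = ‖(g a : K) - f a‖ + ε / 2 * ‖f a‖ := by
          rw [norm_smul, Real.norm_of_nonneg (half_pos hε).le]
      _ ≤ ε / 2 * 1 + ε / 2 * 1 := by
          gcongr
          · exact (hg a).trans (by gcongr)
          · exact (hf a).trans ha
      _ ≤ (1 + ε / 2) * ε := by nlinarith [sq_nonneg ε]
end

section
/- Let K be a real normed space and let (S_i)_{i ∈ I} be a nonempty family of closed linear subspaces of K that is directed under inclusion and whose union is dense in K. Let A be a finite-dimensional real normed space, let f : A → K be a linear isometric embedding, and let ε > 0. Then there exist an index i ∈ I and a linear map f' : A → S_i such that (1−ε)·‖a‖ ≤ ‖f' a‖ ≤ (1+ε)·‖a‖ for all a ∈ A and ‖f' a − f a‖ ≤ ε (computing the difference in K via the inclusion S_i ⊆ K) for every a ∈ A with ‖a‖ ≤ 1. -/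
/-- If the subspaces `S i` are directed with dense union, a linear map out of a finite-dimensional
normed space is approximated, uniformly on the unit ball, by linear maps into some `S i`. -/
theorem exists_linearMap_approx_of_directed_of_dense
    {K : Type*} [NormedAddCommGroup K] [NormedSpace ℝ K]
    {I : Type*} [Nonempty I] {S : I → Submodule ℝ K}
    (hdir : Directed (· ≤ ·) S) (hdense : Dense (⋃ i : I, (S i : Set K)))
    {A : Type*} [NormedAddCommGroup A] [NormedSpace ℝ A] [FiniteDimensional ℝ A]
    (f : A →ₗ[ℝ] K) {ε : ℝ} (hε : 0 < ε) :
    ∃ (i : I) (g : A →ₗ[ℝ] S i), ∀ a : A, ‖(g a : K) - f a‖ ≤ ε * ‖a‖ := by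
  let b := Module.finBasis ℝ A
  obtain ⟨C, hC, hbound⟩ := b.exists_opNorm_le (F := K)
  have hδ : 0 < ε / C := div_pos hε hC
  have happrox (j) : ∃ x ∈ ⋃ i : I, (S i : Set K), ‖x - f (b j)‖ < ε / C := by
    obtain ⟨x, hx, hdist⟩ := hdense.exists_dist_lt (f (b j)) hδ
    exact ⟨x, hx, by rwa [dist_comm, dist_eq_norm] at hdist⟩
  choose x hx hxf using happrox
  choose index hindex using fun j => Set.mem_iUnion.mp (hx j)
  obtain ⟨i, hi⟩ := hdir.finite_le index
  let g : A →ₗ[ℝ] S i := b.constr ℝ fun j => ⟨x j, hi j (hindex j)⟩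
  let u : A →L[ℝ] K := LinearMap.toContinuousLinearMap ((S i).subtype ∘ₗ g - f)
  have hu : ‖u‖ ≤ ε := by
    have h := hbound (u := u) hδ.le fun j => by
      simpa [u, g, Module.Basis.constr_basis] using (hxf j).le
    rwa [mul_div_cancel₀ _ hC.ne'] at h
  exact ⟨i, g, fun a => u.le_of_opNorm_le hu a⟩

theorem stmt_9 {K : Type*} [NormedAddCommGroup K] [NormedSpace ℝ K]
    {I : Type*} [Nonempty I] (S : I → Submodule ℝ K)
    (hclosed : ∀ i : I, IsClosed (S i : Set K))
    (hdir : Directed (· ≤ ·) S)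
    (hdense : Dense (⋃ i : I, (S i : Set K)))
    {A : Type*} [NormedAddCommGroup A] [NormedSpace ℝ A] [FiniteDimensional ℝ A]
    (f : A →ₗ[ℝ] K) (hf : ∀ a : A, ‖f a‖ = ‖a‖)
    (ε : ℝ) (hε : 0 < ε) :
    ∃ (i : I) (f' : A →ₗ[ℝ] (S i)),
      (∀ a : A, (1 - ε) * ‖a‖ ≤ ‖f' a‖ ∧ ‖f' a‖ ≤ (1 + ε) * ‖a‖) ∧
      ∀ a : A, ‖a‖ ≤ 1 → ‖(f' a : K) - f a‖ ≤ ε := by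
  obtain ⟨i, g, hg⟩ := exists_linearMap_approx_of_directed_of_dense hdir hdense f hε
  refine ⟨i, g, fun a => ?_, fun a ha => (hg a).trans (mul_le_of_le_one_right hε.le ha)⟩
  have h := abs_le.mp ((abs_norm_sub_norm_le (g a : K) (f a)).trans (hg a))
  rw [hf, Submodule.norm_coe] at h
  constructor <;> linarith
end

section
/- Let K be a real Banach space of almost universal disposition for finite-dimensional spaces. Let A and A' be finite-dimensional real normed spaces, let ε ≥ 0, and let h : A → A' be a linear map for which there exist a finite-dimensional real normed space C and linear isometric embeddings u : A' → C and v : A → C with ‖u (h x) − v x‖ ≤ ε for all x with ‖x‖ ≤ 1. Then for every linear isometric embedding f : A → K and every δ > 0 there exists a linear isometric embedding f' : A' → K with ‖f' (h x) − f x‖ ≤ ε + δ for all x ∈ A with ‖x‖ ≤ 1. -/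
/-- A real normed space `K` is of almost universal disposition for
finite-dimensional spaces if for every linear isometric embedding `h : A → B`
between finite-dimensional real normed spaces, every linear isometric
embedding `f : A → K` and every `δ > 0` there is a linear isometric embedding
`f' : B → K` with `‖f' (h x) - f x‖ ≤ δ` for all `x` with `‖x‖ ≤ 1`. -/
def AlmostUniversalDisposition (K : Type*) [NormedAddCommGroup K] [NormedSpace ℝ K] : Prop :=
  ∀ (A B : Type) [NormedAddCommGroup A] [NormedSpace ℝ A]
    [NormedAddCommGroup B] [NormedSpace ℝ B],
    FiniteDimensional ℝ A → FiniteDimensional ℝ B →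
    ∀ h : A →ₗ[ℝ] B, (∀ x : A, ‖h x‖ = ‖x‖) →
    ∀ f : A →ₗ[ℝ] K, (∀ x : A, ‖f x‖ = ‖x‖) →
    ∀ δ : ℝ, 0 < δ →
      ∃ f' : B →ₗ[ℝ] K, (∀ x : B, ‖f' x‖ = ‖x‖) ∧
        ∀ x : A, ‖x‖ ≤ 1 → ‖f' (h x) - f x‖ ≤ δ

/-- A witness that the linear map `h : A → A'` is an `ε`-isometry: a
finite-dimensional real normed space `C` together with linear isometric
embeddings `u : A' → C` and `v : A → C` with `‖u (h x) - v x‖ ≤ ε` on the unit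
ball. -/
structure EpsIsometryWitness {A A' : Type} [NormedAddCommGroup A] [NormedSpace ℝ A]
    [NormedAddCommGroup A'] [NormedSpace ℝ A'] (ε : ℝ) (h : A →ₗ[ℝ] A') where
  C : Type
  [instNormed : NormedAddCommGroup C]
  [instSpace : NormedSpace ℝ C]
  finDim : FiniteDimensional ℝ C
  u : A' →ₗ[ℝ] C
  v : A →ₗ[ℝ] C
  u_isometry : ∀ x : A', ‖u x‖ = ‖x‖
  v_isometry : ∀ x : A, ‖v x‖ = ‖x‖
  close : ∀ x : A, ‖x‖ ≤ 1 → ‖u (h x) - v x‖ ≤ ε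

theorem stmt_11 {K : Type*} [NormedAddCommGroup K] [NormedSpace ℝ K] [CompleteSpace K]
    (hK : AlmostUniversalDisposition K)
    {A A' : Type} [NormedAddCommGroup A] [NormedSpace ℝ A] [FiniteDimensional ℝ A]
    [NormedAddCommGroup A'] [NormedSpace ℝ A'] [FiniteDimensional ℝ A']
    (ε : ℝ) (hε : 0 ≤ ε) (h : A →ₗ[ℝ] A')
    (hw : Nonempty (EpsIsometryWitness ε h)) :
    ∀ f : A →ₗ[ℝ] K, (∀ x : A, ‖f x‖ = ‖x‖) →
    ∀ δ : ℝ, 0 < δ →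
      ∃ f' : A' →ₗ[ℝ] K, (∀ x : A', ‖f' x‖ = ‖x‖) ∧
        ∀ x : A, ‖x‖ ≤ 1 → ‖f' (h x) - f x‖ ≤ ε + δ := by
  intro f hf δ hδ
  obtain ⟨C, hC, u, v, hu, hv, huv⟩ := hw
  obtain ⟨g, hg, hgf⟩ := hK A C inferInstance hC v hv f hf δ hδ
  refine ⟨g ∘ₗ u, fun x => (hg (u x)).trans (hu x), fun x hx => ?_⟩
  calc ‖g (u (h x)) - f x‖ = ‖g (u (h x) - v x) + (g (v x) - f x)‖ := by
        rw [map_sub]; abel_nf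
    _ ≤ ‖g (u (h x) - v x)‖ + ‖g (v x) - f x‖ := norm_add_le _ _
    _ ≤ ε + δ := add_le_add ((hg _).trans_le (huv x hx)) (hgf x hx)
end

section
/- Let K and L be separable real Banach spaces, each of almost universal disposition for finite-dimensional spaces. Then K and L are isometrically isomorphic, i.e., there exists a surjective linear isometry K → L. -/
open Filter Topology

/-- A real normed space linearly equivalent to a module in `Type` has an isometric copy in
`Type`. -/
theorem exists_linearIsometryEquiv_of_linearEquiv {E : Type*} [NormedAddCommGroup E]
    [NormedSpace ℝ E] {V : Type} [AddCommGroup V] [Module ℝ V] (e : V ≃ₗ[ℝ] E) :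
    ∃ (W : Type) (_ : NormedAddCommGroup W) (_ : NormedSpace ℝ W), Nonempty (E ≃ₗᵢ[ℝ] W) := by
  let i : NormedAddCommGroup V := NormedAddCommGroup.induced V E e.toLinearMap e.injective
  let j : NormedSpace ℝ V := NormedSpace.induced ℝ V E e.toLinearMap
  exact ⟨V, i, j, ⟨LinearIsometryEquiv.symm ⟨e, fun _ => rfl⟩⟩⟩

/-- Every finite-dimensional real normed space has an isometric copy in `Type`. -/
theorem exists_linearIsometryEquiv_type_zero (E : Type*) [NormedAddCommGroup E] [NormedSpace ℝ E]
    [FiniteDimensional ℝ E] :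
    ∃ (V : Type) (_ : NormedAddCommGroup V) (_ : NormedSpace ℝ V), Nonempty (E ≃ₗᵢ[ℝ] V) :=
  exists_linearIsometryEquiv_of_linearEquiv (Module.finBasis ℝ E).equivFun.symm

/-- The extension property of a space of almost universal disposition, for finite-dimensional
spaces in arbitrary universes. -/
theorem AlmostUniversalDisposition.exists_extension {E A B : Type*}
    [NormedAddCommGroup E] [NormedSpace ℝ E] (hE : AlmostUniversalDisposition E)
    [NormedAddCommGroup A] [NormedSpace ℝ A] [FiniteDimensional ℝ A]
    [NormedAddCommGroup B] [NormedSpace ℝ B] [FiniteDimensional ℝ B]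
    (h : A →ₗᵢ[ℝ] B) (f : A →ₗᵢ[ℝ] E) {δ : ℝ} (hδ : 0 < δ) :
    ∃ g : B →ₗᵢ[ℝ] E, ∀ x, ‖g (h x) - f x‖ ≤ δ * ‖x‖ := by
  obtain ⟨A₀, _, _, ⟨a⟩⟩ := exists_linearIsometryEquiv_type_zero A
  obtain ⟨B₀, _, _, ⟨b⟩⟩ := exists_linearIsometryEquiv_type_zero B
  obtain ⟨g, hg, hgf⟩ := hE A₀ B₀ a.toLinearEquiv.finiteDimensional
    b.toLinearEquiv.finiteDimensional
    ((b.toLinearIsometry.comp (h.comp a.symm.toLinearIsometry)).toLinearMap) (fun x => by simp)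
    ((f.comp a.symm.toLinearIsometry).toLinearMap) (fun x => by simp) δ hδ
  let g' : B →ₗᵢ[ℝ] E := (⟨g, hg⟩ : B₀ →ₗᵢ[ℝ] E).comp b.toLinearIsometry
  have hg' : ∀ x : A, ‖x‖ ≤ 1 → ‖g' (h x) - f x‖ ≤ δ := fun x hx => by
    simpa [g'] using hgf (a x) (by simpa using hx)
  refine ⟨g', fun x => ?_⟩
  rcases eq_or_ne x 0 with rfl | hx
  · simp
  have hx' : 0 < ‖x‖ := norm_pos_iff.2 hx
  have key := hg' (‖x‖⁻¹ • x) (by simp [norm_smul, hx'.ne'])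
  rw [map_smul, map_smul, map_smul, ← smul_sub, norm_smul, norm_inv, norm_norm,
    inv_mul_le_iff₀ hx'] at key
  linarith

/-- One step of the back-and-forth construction. -/
theorem exists_back_and_forth_step {K L : Type*}
    [NormedAddCommGroup K] [NormedSpace ℝ K] [NormedAddCommGroup L] [NormedSpace ℝ L]
    (hK : AlmostUniversalDisposition K) (hL : AlmostUniversalDisposition L)
    (A : Submodule ℝ K) [FiniteDimensional ℝ A] (f : A →ₗᵢ[ℝ] L) (x : K) (y : L)
    {ε : ℝ} (hε : 0 < ε) :
    ∃ (A' : Submodule ℝ K) (_ : FiniteDimensional ℝ A') (f' : A' →ₗᵢ[ℝ] L) (hA : A ≤ A'),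
      x ∈ A' ∧ (∀ a : A, ‖f' (Submodule.inclusion hA a) - f a‖ ≤ ε * ‖a‖) ∧
        ∃ a : A', ‖a‖ = ‖y‖ ∧ ‖f' a - y‖ ≤ ε * ‖y‖ := by
  let B : Submodule ℝ L := LinearMap.range f.toLinearMap ⊔ Submodule.span ℝ {y}
  have hfB : ∀ a, f a ∈ B := fun a =>
    Submodule.mem_sup_left (LinearMap.mem_range_self f.toLinearMap a)
  have hyB : y ∈ B := Submodule.mem_sup_right (Submodule.mem_span_singleton_self y)
  let h : A →ₗᵢ[ℝ] B := ⟨f.toLinearMap.codRestrict B hfB, fun a => f.norm_map a⟩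
  obtain ⟨g, hg⟩ := hK.exists_extension h A.subtypeₗᵢ (half_pos hε)
  let A' : Submodule ℝ K := A ⊔ (LinearMap.range g.toLinearMap ⊔ Submodule.span ℝ {x})
  have hA : A ≤ A' := le_sup_left
  have hgA : ∀ b, g b ∈ A' := fun b =>
    Submodule.mem_sup_right (Submodule.mem_sup_left (LinearMap.mem_range_self g.toLinearMap b))
  have hxA : x ∈ A' := Submodule.mem_sup_right
    (Submodule.mem_sup_right (Submodule.mem_span_singleton_self x))
  let k : B →ₗᵢ[ℝ] A' := ⟨g.toLinearMap.codRestrict A' hgA, fun b => g.norm_map b⟩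
  obtain ⟨f', hf'⟩ := hL.exists_extension k B.subtypeₗᵢ (half_pos hε)
  refine ⟨A', inferInstance, f', hA, hxA, fun a => ?_, k ⟨y, hyB⟩, k.norm_map _, ?_⟩
  · have h₁ : ‖f' (Submodule.inclusion hA a) - f' (k (h a))‖ ≤ ε / 2 * ‖a‖ := by
      rw [← map_sub, f'.norm_map, norm_sub_rev]
      exact hg a
    have h₂ : ‖f' (k (h a)) - f a‖ ≤ ε / 2 * ‖a‖ := by
      have := hf' (h a)
      rwa [h.norm_map] at this
    linarith [norm_sub_le_norm_sub_add_norm_sub (f' (Submodule.inclusion hA a))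
      (f' (k (h a))) (f a)]
  · have h₁ : ‖f' (k ⟨y, hyB⟩) - y‖ ≤ ε / 2 * ‖y‖ := hf' ⟨y, hyB⟩
    nlinarith [norm_nonneg y]

/-- A geometrically convergent sequence of linear isometries on an increasing sequence of
subspaces with dense union has a limit defined on the whole space. -/
theorem exists_limit_linearIsometry {K L : Type*}
    [NormedAddCommGroup K] [NormedSpace ℝ K]
    [NormedAddCommGroup L] [NormedSpace ℝ L] [CompleteSpace L]
    (A : ℕ → Submodule ℝ K) (hA : ∀ n, A n ≤ A (n + 1)) (hd : Dense (⋃ n, (A n : Set K)))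
    (f : ∀ n, A n →ₗᵢ[ℝ] L)
    (hf : ∀ n (x : A n), ‖f (n + 1) (Submodule.inclusion (hA n) x) - f n x‖ ≤ (1 / 2) ^ n * ‖x‖) :
    ∃ F : K →ₗᵢ[ℝ] L, ∀ n (x : A n), ‖F x - f n x‖ ≤ 2 * (1 / 2) ^ n * ‖x‖ := by
  classical
  have hmono : Monotone A := monotone_nat_of_le_succ hA
  let g : ℕ → K → L := fun n x => if hx : x ∈ A n then f n ⟨x, hx⟩ else 0
  have hg : ∀ n x (hx : x ∈ A n), g n x = f n ⟨x, hx⟩ := fun n x hx => dif_pos hx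
  have hdist : ∀ N x, x ∈ A N → ∀ m,
      dist (g (N + m) x) (g (N + (m + 1)) x) ≤ (1 / 2) ^ N * ‖x‖ * (1 / 2) ^ m := by
    intro N x hx m
    have hxm : x ∈ A (N + m) := hmono (Nat.le_add_right N m) hx
    have h₁ := hf (N + m) ⟨x, hxm⟩
    rw [← add_assoc, hg _ x hxm, hg _ x (hA _ hxm), dist_comm, dist_eq_norm]
    refine h₁.trans_eq ?_
    rw [pow_add, Submodule.coe_norm]
    ring
  have hlim : ∀ N x, x ∈ A N → ∃ l, Tendsto (fun n => g n x) atTop (𝓝 l) := by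
    intro N x hx
    obtain ⟨l, hl⟩ := cauchySeq_tendsto_of_complete
      (cauchySeq_of_le_geometric (1 / 2) _ (by norm_num) (hdist N x hx))
    refine ⟨l, (tendsto_add_atTop_iff_nat N).1 ?_⟩
    simpa only [add_comm] using hl
  have hD : ∀ x, x ∈ (⨆ n, A n) ↔ ∃ n, x ∈ A n := fun x =>
    Submodule.mem_iSup_of_directed A hmono.directed_le
  have hex : ∀ x : (⨆ n, A n : Submodule ℝ K), ∃ l, Tendsto (fun n => g n x) atTop (𝓝 l) :=
    fun x => by
      obtain ⟨N, hN⟩ := (hD x).1 x.2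
      exact hlim N x hN
  choose G hG using hex
  have hev : ∀ x : (⨆ n, A n : Submodule ℝ K), ∀ᶠ n in atTop, (x : K) ∈ A n := fun x => by
    obtain ⟨N, hN⟩ := (hD x).1 x.2
    filter_upwards [eventually_ge_atTop N] with n hn using hmono hn hN
  let Gₗ : (⨆ n, A n : Submodule ℝ K) →ₗᵢ[ℝ] L :=
    { toFun := G
      map_add' := fun x y => by
        refine tendsto_nhds_unique (hG (x + y)) (((hG x).add (hG y)).congr' ?_)
        filter_upwards [hev x, hev y] with n hx hy
        rw [Submodule.coe_add, hg n _ hx, hg n _ hy, hg n _ (add_mem hx hy), ← map_add]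
        rfl
      map_smul' := fun c x => by
        refine tendsto_nhds_unique (hG (c • x)) (((hG x).const_smul c).congr' ?_)
        filter_upwards [hev x] with n hx
        rw [Submodule.coe_smul, hg n _ hx, hg n _ (Submodule.smul_mem _ c hx), ← map_smul]
        rfl
      norm_map' := fun x => by
        refine tendsto_nhds_unique (hG x).norm (tendsto_const_nhds.congr' ?_)
        filter_upwards [hev x] with n hx
        rw [hg n _ hx, (f n).norm_map]
        rfl }
  let ι : (⨆ n, A n : Submodule ℝ K) →L[ℝ] K := (⨆ n, A n).subtypeL
  have hdr : DenseRange ι := by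
    refine Dense.mono ?_ hd
    intro x hx
    obtain ⟨n, hn⟩ := Set.mem_iUnion.1 hx
    exact ⟨⟨x, (hD x).2 ⟨n, hn⟩⟩, rfl⟩
  have hui : IsUniformInducing ι := isUniformInducing_val _
  let F : K →L[ℝ] L := Gₗ.toContinuousLinearMap.extend ι
  have hF : ∀ x, F (ι x) = G x := fun x =>
    ContinuousLinearMap.extend_eq Gₗ.toContinuousLinearMap hdr hui x
  have hFn : ∀ x, ‖F x‖ = ‖x‖ := fun x =>
    hdr.induction_on x (isClosed_eq F.continuous.norm continuous_norm) fun z => by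
      rw [hF]
      exact Gₗ.norm_map z
  refine ⟨⟨F.toLinearMap, hFn⟩, fun n x => ?_⟩
  have hxD : (x : K) ∈ (⨆ n, A n) := (hD x).2 ⟨n, x.2⟩
  have hl : Tendsto (fun m => g (n + m) x) atTop (𝓝 (G ⟨x, hxD⟩)) := by
    simpa only [add_comm] using (tendsto_add_atTop_iff_nat n).2 (hG ⟨x, hxD⟩)
  have h₁ := dist_le_of_le_geometric_of_tendsto₀ (1 / 2) _ (by norm_num) (hdist n x x.2) hl
  rw [add_zero, hg n x x.2, dist_comm, dist_eq_norm, ← hF] at h₁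
  refine h₁.trans_eq ?_
  rw [Submodule.coe_norm]
  ring

theorem stmt_12 {K L : Type*}
    [NormedAddCommGroup K] [NormedSpace ℝ K] [CompleteSpace K]
    [TopologicalSpace.SeparableSpace K]
    [NormedAddCommGroup L] [NormedSpace ℝ L] [CompleteSpace L]
    [TopologicalSpace.SeparableSpace L]
    (hK : AlmostUniversalDisposition K) (hL : AlmostUniversalDisposition L) :
    Nonempty (K ≃ₗᵢ[ℝ] L) := by
  let S := Σ' (A : Submodule ℝ K) (_ : FiniteDimensional ℝ A), A →ₗᵢ[ℝ] L
  let u : ℕ → K := TopologicalSpace.denseSeq K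
  let v : ℕ → L := TopologicalSpace.denseSeq L
  have step : ∀ (n : ℕ) (s : S), ∃ t : S, ∃ hA : s.1 ≤ t.1, u n ∈ t.1 ∧
      (∀ a : s.1, ‖t.2.2 (Submodule.inclusion hA a) - s.2.2 a‖ ≤ (1 / 2) ^ n * ‖a‖) ∧
      ∃ a : t.1, ‖a‖ = ‖v n.unpair.1‖ ∧
        ‖t.2.2 a - v n.unpair.1‖ ≤ (1 / 2) ^ n * ‖v n.unpair.1‖ := by
    rintro n ⟨A, hA, f⟩
    obtain ⟨A', hA', f', h, h'⟩ := exists_back_and_forth_step hK hL A f (u n) (v n.unpair.1)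
      (ε := (1 / 2) ^ n) (by positivity)
    exact ⟨⟨A', hA', f'⟩, h, h'⟩
  choose next hle hu hclose hv using step
  let s₀ : S := ⟨⊥, inferInstance, ⟨0, fun x => by simp [Subsingleton.elim x 0]⟩⟩
  let s : ℕ → S := fun n => Nat.rec s₀ next n
  have hd : Dense (⋃ n, ((s n).1 : Set K)) := by
    refine (TopologicalSpace.denseRange_denseSeq K).mono ?_
    rintro _ ⟨n, rfl⟩
    exact Set.mem_iUnion.2 ⟨n + 1, hu n (s n)⟩
  obtain ⟨F, hF⟩ := exists_limit_linearIsometry (fun n => (s n).1) (fun n => hle n (s n)) hd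
    (fun n => (s n).2.2) (fun n => hclose n (s n))
  have hcl : IsClosed (Set.range F) := F.isometry.isClosedEmbedding.isClosed_range
  have hmem : ∀ k, v k ∈ Set.range F := by
    intro k
    have happrox : ∀ m, ∃ a, ‖F a - v k‖ ≤ 2 * (1 / 2) ^ m * ‖v k‖ := by
      intro m
      obtain ⟨a, ha, hav⟩ := hv (Nat.pair k m) (s (Nat.pair k m))
      simp only [Nat.unpair_pair] at ha hav
      have h₁ := hF (Nat.pair k m + 1) a
      rw [ha] at h₁
      have h₂ : (1 / 2 : ℝ) ^ Nat.pair k m ≤ (1 / 2) ^ m :=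
        pow_le_pow_of_le_one (by norm_num) (by norm_num) (Nat.right_le_pair k m)
      have h₃ := mul_le_mul_of_nonneg_right h₂ (norm_nonneg (v k))
      refine ⟨a, (norm_sub_le_norm_sub_add_norm_sub _
        ((s (Nat.pair k m + 1)).2.2 a) _).trans ((add_le_add h₁ hav).trans ?_)⟩
      rw [pow_succ]
      linarith
    choose a ha using happrox
    refine hcl.mem_of_tendsto (f := fun m => F (a m)) (b := atTop) ?_
      (Eventually.of_forall fun m => Set.mem_range_self _)
    refine tendsto_iff_norm_sub_tendsto_zero.2 (squeeze_zero (fun _ => norm_nonneg _) ha ?_)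
    simpa using ((tendsto_pow_atTop_nhds_zero_of_lt_one (r := (1 / 2 : ℝ))
      (by norm_num) (by norm_num)).const_mul 2).mul_const ‖v k‖
  have hsurj : Function.Surjective F := by
    refine Set.range_eq_univ.1 (hcl.closure_eq ▸ ?_)
    refine ((TopologicalSpace.denseRange_denseSeq L).mono ?_).closure_eq
    rintro _ ⟨k, rfl⟩
    exact hmem k
  exact ⟨LinearIsometryEquiv.ofSurjective F hsurj⟩
end

section
/- Let A be a finite metric space, let x, y ∈ A with x ≠ y and dist(x, y) = d, and suppose d ≤ dist(a, b) for all a ≠ b in A (so d is the minimal nonzero distance and 0 < d). Define f : A → ℝ by f(x) = 0 and f(a) = d for a ≠ x, and for a natural number r ≥ 1 let K_r = {0} ∪ {d + 1/k : k a natural number with 1 ≤ k ≤ r} ⊆ ℝ. Then f is nonexpanding, and for every ε with 0 ≤ ε < d and every r ≥ 1 there exists no nonexpanding map g : A → ℝ with g(A) ⊆ K_r and |g(a) − f(a)| ≤ ε for all a ∈ A. -/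
theorem stmt_13 {A : Type*} [MetricSpace A] [Finite A] [DecidableEq A]
    (x y : A) (hxy : x ≠ y) (d : ℝ) (hd : dist x y = d)
    (hmin : ∀ a b : A, a ≠ b → d ≤ dist a b)
    (f : A → ℝ) (hf : ∀ a : A, f a = if a = x then 0 else d) :
    (∀ a b : A, dist (f a) (f b) ≤ dist a b) ∧
    ∀ ε : ℝ, 0 ≤ ε → ε < d → ∀ r : ℕ, 1 ≤ r →
      ¬ ∃ g : A → ℝ, (∀ a b : A, dist (g a) (g b) ≤ dist a b) ∧
        (∀ a : A, g a ∈
          (insert (0 : ℝ) {t : ℝ | ∃ k : ℕ, 1 ≤ k ∧ k ≤ r ∧ t = d + 1 / (k : ℝ)})) ∧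
        ∀ a : A, |g a - f a| ≤ ε := by
  have hd0 : 0 < d := hd ▸ dist_pos.mpr hxy
  refine ⟨fun a b => ?_, ?_⟩
  · rcases eq_or_ne a b with rfl | hab
    · simp
    · refine le_trans ?_ (hmin a b hab)
      rw [hf, hf, Real.dist_eq]
      split_ifs <;> simp [abs_of_pos hd0, hd0.le]
  · rintro ε - hεd r - ⟨g, hg, hgK, hgf⟩
    have hx := hgf x
    have hy := hgf y
    rw [hf, if_pos rfl, sub_zero, abs_le] at hx
    rw [hf, if_neg hxy.symm, abs_le] at hy
    have hgx : g x = 0 := by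
      rcases hgK x with h | ⟨k, -, -, h⟩
      · exact h
      · have : (0 : ℝ) ≤ 1 / (k : ℝ) := by positivity
        linarith
    have hgy : d < g y := by
      rcases hgK y with h | ⟨k, hk, -, h⟩
      · linarith
      · have : (0 : ℝ) < 1 / (k : ℝ) := by positivity
        linarith
    have h := hg x y
    rw [hd, hgx, Real.dist_eq, zero_sub, abs_neg, abs_of_pos (hd0.trans hgy)] at h
    exact hgy.not_ge h
end
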